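/- (Eta Normal Form Lemma) Suppose A = A_1→(...(A_n→a)...) is a functional type, A_{k+1} = C_1→(...(C_p→(B_{k+2}→(...(B_n→a)...)))...), and A_i ≤ B_i for i = k+2, ..., n. Let Y be in beta-eta normal form. If k+1 < i ≤ n and x_1:A_1, ..., x_{k+1}:A_{k+1}, y_{k+2}:A_{k+2}, ..., y_n:A_n ⊢ Y : B_i is derivable in BCD, then Y is the variable y_i. -/

import Mathlib

/-! Common definitions: untyped lambda calculus (de Bruijn), beta/eta reduction,
BCD intersection types, derivations, Böhm-tree notions, numeral systems. -/

inductive Term : Type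
  | var : ℕ → Term
  | app : Term → Term → Term
  | lam : Term → Term
  deriving DecidableEq

namespace Term

/-- Lift the free variables `≥ k` by `d`. -/
def lift (d : ℕ) : ℕ → Term → Term
  | k, var n => if n < k then var n else var (n + d)
  | k, app s t => app (lift d k s) (lift d k t)
  | k, lam t => lam (lift d (k + 1) t)

/-- Substitute `u` for the free variable `k`. -/
def subst (u : Term) : ℕ → Term → Term
  | k, var n => if n = k then lift k 0 u else if k < n then var (n - 1) else var n
  | k, app s t => app (subst u k s) (subst u k t)
  | k, lam t => lam (subst u (k + 1) t)

/-- One-step beta reduction. -/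
inductive Beta : Term → Term → Prop
  | beta (t u : Term) : Beta (app (lam t) u) (subst u 0 t)
  | appL {s s' : Term} (t : Term) : Beta s s' → Beta (app s t) (app s' t)
  | appR (s : Term) {t t' : Term} : Beta t t' → Beta (app s t) (app s t')
  | lam {t t' : Term} : Beta t t' → Beta (lam t) (lam t')

/-- One-step eta reduction. -/
inductive Eta : Term → Term → Prop
  | eta (t : Term) : Eta (lam (app (lift 1 0 t) (var 0))) t
  | appL {s s' : Term} (t : Term) : Eta s s' → Eta (app s t) (app s' t)
  | appR (s : Term) {t t' : Term} : Eta t t' → Eta (app s t) (app s t')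
  | lam {t t' : Term} : Eta t t' → Eta (lam t) (lam t')

/-- One-step beta-eta reduction. -/
def BetaEta (s t : Term) : Prop := Beta s t ∨ Eta s t

/-- Beta-eta conversion. -/
inductive Conv : Term → Term → Prop
  | rel {s t : Term} : BetaEta s t → Conv s t
  | refl (t : Term) : Conv t t
  | symm {s t : Term} : Conv s t → Conv t s
  | trans {s t u : Term} : Conv s t → Conv t u → Conv s u

/-- Beta conversion. -/
inductive BetaConv : Term → Term → Prop
  | rel {s t : Term} : Beta s t → BetaConv s t
  | refl (t : Term) : BetaConv t t
  | symm {s t : Term} : BetaConv s t → BetaConv t s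
  | trans {s t u : Term} : BetaConv s t → BetaConv t u → BetaConv s u

/-- Beta normal form. -/
def BetaNormal (t : Term) : Prop := ∀ u, ¬ Beta t u

/-- Beta-eta normal form. -/
def BetaEtaNormal (t : Term) : Prop := ∀ u, ¬ BetaEta t u

/-- Strongly normalizable (with respect to beta reduction). -/
def SN (t : Term) : Prop := Acc (fun a b => Beta b a) t

/-- All free variables are `< k`. -/
def ClosedUnder : ℕ → Term → Prop
  | k, var n => n < k
  | k, app s t => ClosedUnder k s ∧ ClosedUnder k t
  | k, lam t => ClosedUnder (k + 1) t

/-- Closed term. -/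
def Closed (t : Term) : Prop := ClosedUnder 0 t

/-- Length of the outermost lambda prefix. -/
def prefixLen : Term → ℕ
  | lam t => prefixLen t + 1
  | _ => 0

/-- Strip the outermost lambda prefix. -/
def stripPrefix : Term → Term
  | lam t => stripPrefix t
  | t => t

/-- Head variable of an application spine. -/
def spineHead : Term → Option ℕ
  | var n => some n
  | app s _ => spineHead s
  | lam _ => none

/-- Arguments of an application spine. -/
def spineArgs : Term → List Term
  | app s t => spineArgs s ++ [t]
  | _ => []

/-- Head variable of a Böhm-tree node `λ x_1 ... x_k. x t_1 ... t_l`. -/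
def headOf (t : Term) : Option ℕ := spineHead (stripPrefix t)

/-- Immediate descendants (the arguments) of a Böhm-tree node. -/
def argsOf (t : Term) : List Term := spineArgs (stripPrefix t)

/-- `Desc t d w` : `w` is a node of the Böhm tree of the beta-normal term `t`;
`d` is the number of lambdas crossed strictly above (the root of) `w`. -/
inductive Desc : Term → ℕ → Term → Prop
  | refl (t : Term) : Desc t 0 t
  | step {t u w : Term} {d : ℕ} : u ∈ argsOf t → Desc u d w →
      Desc t (prefixLen t + d) w

/-- `Osc t l` : the Böhm tree of the beta-normal term `t` contains an oscillation
of length `l` whose first pair has the root of `t` as its first coordinate: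
a node `λ x⃗.x` is paired with one of the arguments `u` of this occurrence of `x`
having a non-empty lambda prefix, and the next pair (if it exists) has the head
variable of its first coordinate `w` bound by the lambda prefix of `u`. -/
inductive Osc : Term → ℕ → Prop
  | one {t u : Term} : u ∈ argsOf t → 0 < prefixLen u → Osc t 1
  | succ {t u w : Term} {d h l : ℕ} : u ∈ argsOf t → 0 < prefixLen u →
      Desc u d w → headOf w = some h →
      prefixLen w + d ≤ h + prefixLen u → h < prefixLen w + d →
      Osc w l → Osc t (l + 1)

/-- `X` has class `n` : every lambda prefix in the Böhm tree of `X` has at most `n`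
lambdas, every node has at most `n` immediate descendants, and every oscillation
has length at most `n`. -/
def HasClass (n : ℕ) (X : Term) : Prop :=
  (∀ d w, Desc X d w → prefixLen w ≤ n ∧ (argsOf w).length ≤ n) ∧
  (∀ d w l, Desc X d w → Osc w l → l ≤ n)

/-- Depth of the Böhm tree of a beta-normal term. -/
def tdepth : Term → ℕ
  | var _ => 0
  | lam t => tdepth t
  | app s t => max (tdepth s) (tdepth t + 1)

end Term

/-- `iterApp f n x = f (f ( ... (f x)))`, `n` times. -/
def iterApp (f : Term) : ℕ → Term → Term
  | 0, x => x
  | n + 1, x => Term.app f (iterApp f n x)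

/-- Church numeral. -/
def church (n : ℕ) : Term := Term.lam (Term.lam (iterApp (Term.var 1) n (Term.var 0)))

/-- A fixed effective Gödel numbering of lambda terms. -/
def gnum : Term → ℕ
  | Term.var n => Nat.pair 0 n
  | Term.app s t => Nat.pair 1 (Nat.pair (gnum s) (gnum t))
  | Term.lam t => Nat.pair 2 (gnum t)

/-- Intersection types (no top element). -/
inductive Ty : Type
  | atom : ℕ → Ty
  | arrow : Ty → Ty → Ty
  | inter : Ty → Ty → Ty
  deriving DecidableEq

namespace Ty

/-- The subtype preorder on intersection types (the "Traditional" system). -/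
inductive Sub : Ty → Ty → Prop
  | refl (A : Ty) : Sub A A
  | trans {A B C : Ty} : Sub A B → Sub B C → Sub A C
  | interL (A B : Ty) : Sub (inter A B) A
  | interR (A B : Ty) : Sub (inter A B) B
  | interGlb {C A B : Ty} : Sub C A → Sub C B → Sub C (inter A B)
  | arrow {A B C D : Ty} : Sub A C → Sub D B → Sub (arrow C D) (arrow A B)
  | dist (A B C : Ty) : Sub (inter (arrow A B) (arrow A C)) (arrow A (inter B C))

def IsInter : Ty → Prop
  | inter _ _ => True
  | _ => False

/-- Dist normal form: no subexpression of the shape `A → (B ∧ C)`. -/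
def Dnf : Ty → Prop
  | atom _ => True
  | arrow A B => Dnf A ∧ Dnf B ∧ ¬ IsInter B
  | inter A B => Dnf A ∧ Dnf B

/-- `occ a s A` : the number of occurrences of the atom `a` in `A` whose sign is `s`
(`true` = positive, `false` = negative); signs are preserved in the right argument
of `→` and in both arguments of `∧`, and flipped in the left argument of `→`. -/
def occ (a : ℕ) : Bool → Ty → ℕ
  | s, atom b => if s then (if a = b then 1 else 0) else 0
  | s, arrow C B => occ a (!s) C + occ a s B
  | s, inter C B => occ a s C + occ a s B

/-- `interOcc s A` : the number of occurrences of `∧` in `A` with sign `s`. -/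
def interOcc : Bool → Ty → ℕ
  | _, atom _ => 0
  | s, arrow C B => interOcc (!s) C + interOcc s B
  | s, inter C B => (if s then 1 else 0) + interOcc s C + interOcc s B

/-- A type in dnf is functional if each atom occurs at most twice, any two
occurrences of the same atom have opposite sign, and `∧` has no positive
occurrence. -/
def Functional (A : Ty) : Prop :=
  Dnf A ∧ (∀ a, occ a true A ≤ 1 ∧ occ a false A ≤ 1) ∧ interOcc true A = 0

/-- Co-functional: as `Functional` but `∧` has no negative occurrence. -/
def CoFunctional (A : Ty) : Prop :=
  Dnf A ∧ (∀ a, occ a true A ≤ 1 ∧ occ a false A ≤ 1) ∧ interOcc false A = 0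

/-- Tropical evaluation of a type at the valuation `v` of the atom variables, at
sign `s`; `te v true A` is `e(A)` and `te v false A` is its dual `~e(A)`. -/
def te (v : ℕ → ℕ) : Bool → Ty → ℕ
  | _, atom a => v a
  | s, arrow C B => 1 + te v (!s) C + te v s B
  | s, inter C B => if s then min (te v s C) (te v s B) else max (te v s C) (te v s B)

/-- slat congruence : the congruence generated by associativity and commutativity
of `∧` and idempotence `A ~ A ∧ A`. -/
inductive Slat : Ty → Ty → Prop
  | refl (A : Ty) : Slat A A
  | symm {A B : Ty} : Slat A B → Slat B A
  | trans {A B C : Ty} : Slat A B → Slat B C → Slat A C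
  | assoc (A B C : Ty) : Slat (inter A (inter B C)) (inter (inter A B) C)
  | comm (A B : Ty) : Slat (inter A B) (inter B A)
  | idem (A : Ty) : Slat A (inter A A)
  | arrowCong {A A' B B' : Ty} : Slat A A' → Slat B B' → Slat (arrow A B) (arrow A' B')
  | interCong {A A' B B' : Ty} : Slat A A' → Slat B B' → Slat (inter A B) (inter A' B')

/-- The `i`-th argument type along the arrows of a type. -/
def argTy : Ty → ℕ → Option Ty
  | arrow A _, 0 => some A
  | arrow _ B, n + 1 => argTy B n
  | _, _ => none

/-- The principal atoms (the end atoms of the components) of a type in dnf. -/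
def principalAtoms : Ty → List ℕ
  | atom a => [a]
  | arrow _ B => principalAtoms B
  | inter A B => principalAtoms A ++ principalAtoms B

/-- All atoms occurring in a type. -/
def atoms : Ty → List ℕ
  | atom a => [a]
  | arrow A B => atoms A ++ atoms B
  | inter A B => atoms A ++ atoms B

/-- `arrows [A₁, ..., Aₙ] B = A₁ → ( ... (Aₙ → B) ...)`. -/
def arrows (l : List Ty) (b : Ty) : Ty := l.foldr Ty.arrow b

end Ty

/-- One-hole contexts for types. -/
inductive Ctx : Type
  | hole : Ctx
  | arrowL : Ctx → Ty → Ctx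
  | arrowR : Ty → Ctx → Ctx
  | interL : Ctx → Ty → Ctx
  | interR : Ty → Ctx → Ctx

namespace Ctx

/-- Fill the hole of a context with a type. -/
def fill : Ctx → Ty → Ty
  | hole, A => A
  | arrowL C B, A => Ty.arrow (fill C A) B
  | arrowR B C, A => Ty.arrow B (fill C A)
  | interL C B, A => Ty.inter (fill C A) B
  | interR B C, A => Ty.inter B (fill C A)

/-- Sign of the hole of a context (`true` = positive occurrence). -/
def sign : Ctx → Bool
  | hole => true
  | arrowL C _ => !(sign C)
  | arrowR _ C => sign C
  | interL C _ => sign C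
  | interR _ C => sign C

/-- The hole is strictly positive: it never passes through the left argument
of an `→`. -/
def strictPos : Ctx → Prop
  | hole => True
  | arrowL _ _ => False
  | arrowR _ C => strictPos C
  | interL C _ => strictPos C
  | interR _ C => strictPos C

end Ctx

/-- The Munich system for the subtype relation. -/
inductive Munich : Ty → Ty → Prop
  | slat {A B : Ty} : Ty.Slat A B → Munich A B
  | distrib (E D : Ctx) (B C : Ty) : D.strictPos →
      Munich (E.fill (D.fill (Ty.inter B C))) (E.fill (Ty.inter (D.fill B) (D.fill C)))
  | posElim (E : Ctx) (B C : Ty) : E.sign = true →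
      Munich (E.fill (Ty.inter B C)) (E.fill B)
  | negIntro (E : Ctx) (B C : Ty) : E.sign = false →
      Munich (E.fill B) (E.fill (Ty.inter B C))
  | trans {A B C : Ty} : Munich A B → Munich B C → Munich A C

/-- BCD derivations (as proof trees). A basis is a finite list of types, the
variable `var n` receiving the `n`-th type of the list. -/
inductive Deriv : List Ty → Term → Ty → Type
  | var (Γ : List Ty) (n : ℕ) (A : Ty) : Γ[n]? = some A → Deriv Γ (Term.var n) A
  | lam (Γ : List Ty) (t : Term) (A B : Ty) :
      Deriv (A :: Γ) t B → Deriv Γ (Term.lam t) (Ty.arrow A B)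
  | app (Γ : List Ty) (s t : Term) (A B : Ty) :
      Deriv Γ s (Ty.arrow A B) → Deriv Γ t A → Deriv Γ (Term.app s t) B
  | inter (Γ : List Ty) (t : Term) (A B : Ty) :
      Deriv Γ t A → Deriv Γ t B → Deriv Γ t (Ty.inter A B)
  | sub (Γ : List Ty) (t : Term) (A B : Ty) :
      Deriv Γ t A → Ty.Sub A B → Deriv Γ t B

/-- BCD derivability. -/
def BCD (Γ : List Ty) (t : Term) (A : Ty) : Prop := Nonempty (Deriv Γ t A)

/-- All the types of a basis are in dist normal form. -/
def CtxDnf (Γ : List Ty) : Prop := ∀ B ∈ Γ, Ty.Dnf B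

namespace Deriv

/-- Every type expression occurring in the derivation is in dist normal form. -/
def allDnf : {Γ : List Ty} → {t : Term} → {A : Ty} → Deriv Γ t A → Prop
  | _, _, _, var Γ _ A _ => CtxDnf Γ ∧ Ty.Dnf A
  | _, _, _, lam _ _ A B d => Ty.Dnf (Ty.arrow A B) ∧ allDnf d
  | _, _, _, app _ _ _ _ _ d e => allDnf d ∧ allDnf e
  | _, _, _, inter _ _ _ _ d e => allDnf d ∧ allDnf e
  | _, _, _, sub _ _ _ B d _ => Ty.Dnf B ∧ allDnf d

/-- Every application of the subtyping rule has a variable as its subject. -/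
def subOnVar : {Γ : List Ty} → {t : Term} → {A : Ty} → Deriv Γ t A → Prop
  | _, _, _, var _ _ _ _ => True
  | _, _, _, lam _ _ _ _ d => subOnVar d
  | _, _, _, app _ _ _ _ _ d e => subOnVar d ∧ subOnVar e
  | _, _, _, inter _ _ _ _ d e => subOnVar d ∧ subOnVar e
  | _, _, _, sub _ t _ _ d _ => (∃ n, t = Term.var n) ∧ subOnVar d

/-- `temperate d m` : the derivation contains no intemperate sequence, where `m`
applications are pending above the root of `d`: no subtyping inference may
change an argument type at a position that is subsequently consumed by an
application. -/
def temperate : {Γ : List Ty} → {t : Term} → {A : Ty} → Deriv Γ t A → ℕ → Prop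
  | _, _, _, var _ _ _ _, _ => True
  | _, _, _, lam _ _ _ _ d, _ => temperate d 0
  | _, _, _, app _ _ _ _ _ d e, m => temperate d (m + 1) ∧ temperate e 0
  | _, _, _, inter _ _ _ _ d e, _ => temperate d 0 ∧ temperate e 0
  | _, _, _, sub _ _ A B d _, m =>
      (∀ i < m, Ty.argTy A i = Ty.argTy B i) ∧ temperate d m

/-- Almost minimal derivation. -/
def AM {Γ : List Ty} {t : Term} {A : Ty} (d : Deriv Γ t A) : Prop :=
  allDnf d ∧ subOnVar d ∧ temperate d 0

/-- `avoids d k` : the variable (currently of index) `k` is not used in the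
derivation `d`. -/
def avoids : {Γ : List Ty} → {t : Term} → {A : Ty} → Deriv Γ t A → ℕ → Prop
  | _, _, _, var _ n _ _, k => n ≠ k
  | _, _, _, lam _ _ _ _ d, k => avoids d (k + 1)
  | _, _, _, app _ _ _ _ _ d e, k => avoids d k ∧ avoids e k
  | _, _, _, inter _ _ _ _ d e, k => avoids d k ∧ avoids e k
  | _, _, _, sub _ _ _ _ d _, k => avoids d k

end Deriv

def Kterm : Term := Term.lam (Term.lam (Term.var 1))
def KstarTerm : Term := Term.lam (Term.lam (Term.var 0))

def applyList : Term → List Term → Term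
  | M, [] => M
  | M, a :: l => applyList (Term.app M a) l

/-- Solvability of a closed term. -/
def Solvable (M : Term) : Prop :=
  ∃ args : List Term, Term.Conv (applyList M args) (Term.lam (Term.var 0))

/-- A numeral system: a sequence of closed terms together with a successor `S`
and a zero test `Z`. -/
def NumeralSystem (d : ℕ → Term) : Prop :=
  (∀ n, Term.Closed (d n)) ∧
  ∃ S Z : Term, Term.Closed S ∧ Term.Closed Z ∧
    (∀ n, Term.Conv (Term.app S (d n)) (d (n + 1))) ∧
    Term.Conv (Term.app Z (d 0)) KstarTerm ∧
    (∀ n, 0 < n → Term.Conv (Term.app Z (d n)) Kterm)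

/-- Lambda definability of a partial function on a numeral system. -/
def LambdaDefinableOn (d : ℕ → Term) (f : ℕ →. ℕ) : Prop :=
  ∃ F : Term, Term.Closed F ∧
    (∀ n m, m ∈ f n → Term.Conv (Term.app F (d n)) (d m)) ∧
    (∀ n, ¬ (f n).Dom → ¬ Solvable (Term.app F (d n)))

/-- Adequacy: every partial recursive function is lambda definable on the system. -/
def Adequate (d : ℕ → Term) : Prop :=
  ∀ f : ℕ →. ℕ, Nat.Partrec f → LambdaDefinableOn d f

/-- `FG i r k` builds `f(λ x_{k+1}. f( ... f(λ x_n. x_i) ...))` with `r = n - k`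
remaining levels, in the context `f, x_1, ..., x_k`. -/
def FG (i : ℕ) : ℕ → ℕ → Term
  | 0, k => Term.var (k - i)
  | r + 1, k => Term.app (Term.var k) (Term.lam (FG i r (k + 1)))

/-- `Fterm i n = λ f. f(λ x₁. f(λ x₂. ... f(λ xₙ. x_i) ...))`. -/
def Fterm (i n : ℕ) : Term := Term.lam (FG i n 0)

/-- `X'` is an eta expansion of `X`. -/
def EtaExpandsTo (X X' : Term) : Prop :=
  Relation.ReflTransGen (fun a b => Term.Eta b a) X X'

/-- New normal form (for the parameter `n`): beta normal, every lambda prefix in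
the Böhm tree has length `n+1` except the newly introduced eta variables (length
`0`), and every maximal oscillation has length `n+1`. -/
def NewNF (n : ℕ) (X : Term) : Prop :=
  Term.BetaNormal X ∧
  (∀ d w, Term.Desc X d w → Term.prefixLen w = n + 1 ∨ Term.prefixLen w = 0) ∧
  (∀ d w l, Term.Desc X d w → Term.Osc w l → Term.Osc w (l + 1) ∨ l = n + 1)

/-- Having a beta normal form. -/
def HasBetaNF (M : Term) : Prop :=
  ∃ N, Relation.ReflTransGen Term.Beta M N ∧ Term.BetaNormal N

/-- The map taking a term of `S` to the Gödel number of its beta-eta normal form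
is representable. -/
def GodelRepresentable (S : Set Term) : Prop :=
  ∃ M : Term, Term.Closed M ∧
    ∀ N ∈ S, Term.BetaEtaNormal N → Term.Conv (Term.app M N) (church (gnum N))

/-- The set `S` (closed under beta-eta conversion) forms an adequate numeral
system. -/
def IsAdequateNumeralSystem (S : Set Term) : Prop :=
  ∃ d : ℕ → Term, NumeralSystem d ∧ Adequate d ∧
    (∀ n, d n ∈ S) ∧ (∀ M ∈ S, ∃ n, Term.Conv M (d n)) ∧
    (∀ n m, Term.Conv (d n) (d m) → n = m)

namespace Ty

/-- The components of a type: `A` is equivalent to the intersection of the types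
`arrows α.1 (atom α.2)` for `α ∈ comps A`. -/
def comps : Ty → List (List Ty × ℕ)
  | atom a => [([], a)]
  | arrow A B => (comps B).map fun α => (A :: α.1, α.2)
  | inter A B => comps A ++ comps B

/-- The number of components of a type ending in the atom `c`. -/
def principalCount (c : ℕ) (A : Ty) : ℕ := (comps A).countP fun α => α.2 = c

theorem principalCount_arrow (c : ℕ) (A B : Ty) :
    principalCount c (arrow A B) = principalCount c B := by
  simp [principalCount, comps, List.countP_map, Function.comp_def]

theorem principalCount_inter (c : ℕ) (A B : Ty) :
    principalCount c (inter A B) = principalCount c A + principalCount c B := by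
  simp [principalCount, comps]

theorem principalCount_le_occ (c : ℕ) (A : Ty) : principalCount c A ≤ occ c true A := by
  induction A with
  | atom b =>
    by_cases h : c = b
    · simp [principalCount, comps, occ, h]
    · simp [principalCount, comps, occ, Ne.symm h]
  | arrow A B _ ihB => rw [principalCount_arrow]; simp only [occ]; omega
  | inter A B ihA ihB => rw [principalCount_inter]; simp only [occ]; omega

theorem sum_occ_add_principalCount_le (c : ℕ) (A : Ty) (α : List Ty × ℕ) (h : α ∈ comps A) :
    (α.1.map (occ c false)).sum + principalCount c A ≤ occ c true A := by
  induction A generalizing α with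
  | atom b =>
    have := principalCount_le_occ c (atom b)
    simp only [comps, List.mem_singleton] at h
    subst h
    simpa using this
  | arrow A B _ ihB =>
    simp only [comps, List.mem_map] at h
    obtain ⟨γ, hγ, rfl⟩ := h
    have := ihB γ hγ
    rw [principalCount_arrow]
    simp only [List.map_cons, List.sum_cons, occ, Bool.not_true]
    omega
  | inter A B ihA ihB =>
    have hA := principalCount_le_occ c A
    have hB := principalCount_le_occ c B
    rw [principalCount_inter]
    simp only [occ]
    rcases List.mem_append.1 h with h | h
    · have := ihA α h; omega
    · have := ihB α h; omega

theorem interOcc_eq_zero_of_mem_comps (A : Ty) (α : List Ty × ℕ) (h : α ∈ comps A)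
    (hA : interOcc false A = 0) : ∀ E ∈ α.1, interOcc true E = 0 := by
  induction A generalizing α with
  | atom b =>
    simp only [comps, List.mem_singleton] at h
    subst h
    simp
  | arrow A B _ ihB =>
    simp only [comps, List.mem_map] at h
    obtain ⟨γ, hγ, rfl⟩ := h
    simp only [interOcc, Bool.not_false] at hA
    have := ihB γ hγ (by omega)
    simp only [List.mem_cons, forall_eq_or_imp]
    exact ⟨by omega, this⟩
  | inter A B ihA ihB =>
    simp only [interOcc] at hA
    rcases List.mem_append.1 h with h | h
    · exact ihA α h (by omega)
    · exact ihB α h (by omega)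

theorem exists_eq_arrows (G : Ty) (h : interOcc true G = 0) : ∃ D b, G = arrows D (atom b) := by
  induction G with
  | atom b => exact ⟨[], b, rfl⟩
  | arrow A B _ ihB =>
    simp only [interOcc] at h
    obtain ⟨D, b, rfl⟩ := ihB (by omega)
    exact ⟨A :: D, b, rfl⟩
  | inter A B _ _ => simp [interOcc] at h

theorem comps_arrows (D : List Ty) (b : ℕ) : comps (arrows D (atom b)) = [(D, b)] := by
  induction D with
  | nil => rfl
  | cons A D ih =>
    change comps (arrow A (arrows D (atom b))) = _
    simp [comps, ih]

theorem occ_false_arrows (c : ℕ) (D : List Ty) (b : ℕ) :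
    occ c false (arrows D (atom b)) = (D.map (occ c true)).sum := by
  induction D with
  | nil => rfl
  | cons A D ih =>
    change occ c false (arrow A (arrows D (atom b))) = _
    simp [occ, ih]

theorem interOcc_false_of_arrows (D : List Ty) (b : ℕ)
    (h : interOcc true (arrows D (atom b)) = 0) : ∀ E ∈ D, interOcc false E = 0 := by
  induction D with
  | nil => simp
  | cons A D ih =>
    change interOcc true (arrow A (arrows D (atom b))) = 0 at h
    simp only [interOcc, Bool.not_true] at h
    simp only [List.mem_cons, forall_eq_or_imp]
    exact ⟨by omega, ih (by omega)⟩

theorem forall₂_sub_trans {l₁ l₂ l₃ : List Ty} (h : List.Forall₂ Sub l₁ l₂)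
    (h' : List.Forall₂ Sub l₂ l₃) : List.Forall₂ Sub l₁ l₃ := by
  induction h generalizing l₃ with
  | nil => exact h'
  | cons hAB _ ih =>
    cases h' with
    | cons hBC hl => exact .cons (hAB.trans hBC) (ih hl)

theorem Sub.exists_mem_comps {A B : Ty} (h : Sub A B) : ∀ β ∈ comps B,
    ∃ α ∈ comps A, α.2 = β.2 ∧ List.Forall₂ Sub β.1 α.1 := by
  have hrefl (l : List Ty) : List.Forall₂ Sub l l := List.forall₂_same.2 fun A _ => Sub.refl A
  induction h with
  | refl A => exact fun β hβ => ⟨β, hβ, rfl, hrefl _⟩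
  | trans _ _ ih₁ ih₂ =>
    intro γ hγ
    obtain ⟨β, hβ, e₁, f₁⟩ := ih₂ γ hγ
    obtain ⟨α, hα, e₂, f₂⟩ := ih₁ β hβ
    exact ⟨α, hα, e₂.trans e₁, forall₂_sub_trans f₁ f₂⟩
  | interL A B => exact fun β hβ => ⟨β, List.mem_append_left _ hβ, rfl, hrefl _⟩
  | interR A B => exact fun β hβ => ⟨β, List.mem_append_right _ hβ, rfl, hrefl _⟩
  | interGlb _ _ ih₁ ih₂ =>
    intro β hβ
    rcases List.mem_append.1 hβ with hβ | hβ
    · exact ih₁ β hβ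
    · exact ih₂ β hβ
  | arrow hAC _ _ ih =>
    intro β hβ
    simp only [comps, List.mem_map] at hβ
    obtain ⟨γ, hγ, rfl⟩ := hβ
    obtain ⟨α, hα, e, f⟩ := ih γ hγ
    exact ⟨_, List.mem_map.2 ⟨α, hα, rfl⟩, e, .cons hAC f⟩
  | dist A B C =>
    intro β hβ
    refine ⟨β, ?_, rfl, hrefl _⟩
    simpa [comps] using hβ

theorem sub_arrows_of_forall₂ {D E : List Ty} (b : ℕ) (h : List.Forall₂ Sub D E) :
    Sub (arrows E (atom b)) (arrows D (atom b)) := by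
  induction h with
  | nil => exact Sub.refl _
  | cons h _ ih => exact Sub.arrow h ih

theorem sub_of_mem_comps (A : Ty) : ∀ β ∈ comps A, Sub A (arrows β.1 (atom β.2)) := by
  induction A with
  | atom b =>
    intro β hβ
    simp only [comps, List.mem_singleton] at hβ
    subst hβ
    exact Sub.refl _
  | arrow A B _ ihB =>
    intro β hβ
    simp only [comps, List.mem_map] at hβ
    obtain ⟨γ, hγ, rfl⟩ := hβ
    exact Sub.arrow (Sub.refl A) (ihB γ hγ)
  | inter A B ihA ihB =>
    intro β hβ
    rcases List.mem_append.1 hβ with hβ | hβ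
    · exact (Sub.interL A B).trans (ihA β hβ)
    · exact (Sub.interR A B).trans (ihB β hβ)

/-- If at most one component of the types in a basis ends in the atom `b`, then any two
components ending in `b` belong to the same variable and coincide. -/
theorem comps_unique {b : ℕ} {Δ : List Ty} (h : (Δ.map (principalCount b)).sum ≤ 1)
    {p q : ℕ} {U V : Ty} (hU : Δ[p]? = some U) (hV : Δ[q]? = some V) {α β : List Ty × ℕ}
    (hα : α ∈ comps U) (hβ : β ∈ comps V) (eα : α.2 = b) (eβ : β.2 = b) : p = q ∧ α = β := by
  have hpos {W : Ty} {γ : List Ty × ℕ} (hγ : γ ∈ comps W) (e : γ.2 = b) :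
      0 < principalCount b W := List.countP_pos_iff.2 ⟨γ, hγ, by simpa using e⟩
  have hle {l : List Ty} {p : ℕ} {W : Ty} (hW : l[p]? = some W) :
      principalCount b W ≤ (l.map (principalCount b)).sum :=
    List.le_sum_of_mem (List.mem_map.2 ⟨W, List.mem_of_getElem? hW, rfl⟩)
  have hpq : p = q := by
    induction Δ generalizing p q with
    | nil => simp at hU
    | cons W l ih =>
      simp only [List.map_cons, List.sum_cons] at h
      have h₁ := hpos hα eα
      have h₂ := hpos hβ eβ
      cases p with
      | zero =>
        cases q with
        | zero => rfl
        | succ q =>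
          simp only [List.getElem?_cons_zero, Option.some.injEq] at hU
          rw [List.getElem?_cons_succ] at hV
          subst hU
          have := hle hV
          omega
      | succ p =>
        rw [List.getElem?_cons_succ] at hU
        cases q with
        | zero =>
          simp only [List.getElem?_cons_zero, Option.some.injEq] at hV
          subst hV
          have := hle hU
          omega
        | succ q =>
          rw [List.getElem?_cons_succ] at hV
          rw [ih (by omega) hU hV]
  refine ⟨hpq, ?_⟩
  subst hpq
  obtain rfl : U = V := Option.some.inj (hU.symm.trans hV)
  have h₁ := (hle hU).trans h
  rw [principalCount, List.countP_eq_length_filter] at h₁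
  have hmem {γ : List Ty × ℕ} (hγ : γ ∈ comps U) (e : γ.2 = b) :
      γ ∈ (comps U).filter fun γ => γ.2 = b := List.mem_filter.2 ⟨hγ, by simpa using e⟩
  obtain ⟨γ, e⟩ := List.length_eq_one_iff.1 (h₁.antisymm (List.length_pos_of_mem (hmem hα eα)))
  exact (List.mem_singleton.1 (e ▸ hmem hα eα)).trans (List.mem_singleton.1 (e ▸ hmem hβ eβ)).symm

end Ty

namespace BCD

open Ty

theorem sub {Γ : List Ty} {t : Term} {A B : Ty} (h : BCD Γ t A) (hs : Sub A B) : BCD Γ t B :=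
  h.elim fun d => ⟨.sub _ _ _ _ d hs⟩

theorem of_deriv_of_forall₂ {Γ Δ : List Ty} {t : Term} {A : Ty} (d : Deriv Γ t A)
    (h : List.Forall₂ Sub Δ Γ) : BCD Δ t A := by
  induction d generalizing Δ with
  | var Γ n A hn =>
    obtain ⟨hl, hg⟩ := List.forall₂_iff_get.1 h
    obtain ⟨hn', rfl⟩ := List.getElem?_eq_some_iff.1 hn
    exact ⟨.sub _ _ _ _ (.var _ n _ (List.getElem?_eq_getElem (hl ▸ hn'))) (hg n _ hn')⟩
  | lam Γ t A B _ ih => exact (ih (.cons (Sub.refl A) h)).elim fun d => ⟨.lam _ _ _ _ d⟩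
  | app Γ s t A B _ _ ih₁ ih₂ =>
    exact (ih₁ h).elim fun d => (ih₂ h).elim fun e => ⟨.app _ _ _ _ _ d e⟩
  | inter Γ t A B _ _ ih₁ ih₂ =>
    exact (ih₁ h).elim fun d => (ih₂ h).elim fun e => ⟨.inter _ _ _ _ d e⟩
  | sub Γ t A B _ hs ih => exact (ih h).sub hs

theorem var_inv {Γ : List Ty} {n : ℕ} {A : Ty} (h : BCD Γ (.var n) A) :
    ∃ U, Γ[n]? = some U ∧ Sub U A := by
  obtain ⟨d⟩ := h
  generalize ht : Term.var n = t at d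
  induction d with
  | var Γ m A hm =>
    cases ht
    exact ⟨A, hm, Sub.refl A⟩
  | lam => cases ht
  | app => cases ht
  | inter Γ t A B _ _ ih₁ ih₂ =>
    obtain ⟨U, hU, h₁⟩ := ih₁ ht
    obtain ⟨V, hV, h₂⟩ := ih₂ ht
    obtain rfl : U = V := Option.some.inj (hU.symm.trans hV)
    exact ⟨U, hU, h₁.interGlb h₂⟩
  | sub Γ t A B _ hs ih =>
    obtain ⟨U, hU, h₁⟩ := ih ht
    exact ⟨U, hU, h₁.trans hs⟩

theorem app_inv {Γ : List Ty} {s u : Term} {A : Ty} (h : BCD Γ (.app s u) A) :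
    ∀ β ∈ comps A, ∃ V, BCD Γ s (.arrow V (arrows β.1 (.atom β.2))) ∧ BCD Γ u V := by
  obtain ⟨d⟩ := h
  generalize ht : Term.app s u = t at d
  induction d with
  | var => cases ht
  | lam => cases ht
  | app Γ s' t' A B d e _ _ =>
    cases ht
    exact fun β hβ => ⟨A, BCD.sub ⟨d⟩ (Sub.arrow (Sub.refl A) (sub_of_mem_comps B β hβ)), ⟨e⟩⟩
  | inter Γ t A B _ _ ih₁ ih₂ =>
    intro β hβ
    rcases List.mem_append.1 hβ with hβ | hβ
    · exact ih₁ ht β hβ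
    · exact ih₂ ht β hβ
  | sub Γ t A B _ hs ih =>
    intro β hβ
    obtain ⟨α, hα, e, f⟩ := hs.exists_mem_comps β hβ
    obtain ⟨V, h₁, h₂⟩ := ih ht α hα
    exact ⟨V, h₁.sub (Sub.arrow (Sub.refl V) (e ▸ sub_arrows_of_forall₂ _ f)), h₂⟩

theorem lam_inv {Γ : List Ty} {s : Term} {A : Ty} (h : BCD Γ (.lam s) A) :
    ∀ β ∈ comps A, ∃ V D, β.1 = V :: D ∧ BCD (V :: Γ) s (arrows D (.atom β.2)) := by
  obtain ⟨d⟩ := h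
  generalize ht : Term.lam s = t at d
  induction d with
  | var => cases ht
  | app => cases ht
  | lam Γ t A B d _ =>
    cases ht
    intro β hβ
    simp only [comps, List.mem_map] at hβ
    obtain ⟨γ, hγ, rfl⟩ := hβ
    exact ⟨A, γ.1, rfl, BCD.sub ⟨d⟩ (sub_of_mem_comps B γ hγ)⟩
  | inter Γ t A B _ _ ih₁ ih₂ =>
    intro β hβ
    rcases List.mem_append.1 hβ with hβ | hβ
    · exact ih₁ ht β hβ
    · exact ih₂ ht β hβ
  | sub Γ t A B _ hs ih =>
    intro β hβ
    obtain ⟨α, hα, e, f⟩ := hs.exists_mem_comps β hβ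
    obtain ⟨V, D, h₁, ⟨d⟩⟩ := ih ht α hα
    rw [h₁] at f
    obtain ⟨W, D', hW, f', e'⟩ := List.forall₂_cons_right_iff.1 f
    refine ⟨W, D', e', ?_⟩
    have := of_deriv_of_forall₂ d
      (.cons hW (List.forall₂_same.2 fun A _ => Sub.refl A) : List.Forall₂ Sub (W :: Γ) (V :: Γ))
    rw [e] at this
    exact this.sub (sub_arrows_of_forall₂ _ f')

theorem lams_inv {r : ℕ} {Γ D : List Ty} {t : Term} {b : ℕ}
    (h : BCD Γ (Term.lam^[r] t) (arrows D (.atom b))) :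
    r ≤ D.length ∧ BCD ((D.take r).reverse ++ Γ) t (arrows (D.drop r) (.atom b)) := by
  induction r generalizing Γ D with
  | zero => simpa using h
  | succ r ih =>
    rw [Function.iterate_succ_apply'] at h
    obtain ⟨V, D', e, h'⟩ := h.lam_inv (D, b) (by simp [comps_arrows])
    obtain rfl : D = V :: D' := e
    obtain ⟨h₁, h₂⟩ := ih h'
    simp only [List.length_cons, List.take_succ_cons, List.reverse_cons, List.append_assoc,
      List.drop_succ_cons]
    exact ⟨by omega, h₂⟩

theorem spine_inv {Γ : List Ty} {h b : ℕ} (M : List Term) {D : List Ty}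
    (hM : BCD Γ (M.foldl Term.app (.var h)) (arrows D (.atom b))) :
    ∃ U, Γ[h]? = some U ∧ ∃ E F, (E ++ F, b) ∈ comps U ∧ List.Forall₂ (BCD Γ) M E ∧
      List.Forall₂ Sub D F := by
  induction M using List.reverseRecOn generalizing D with
  | nil =>
    obtain ⟨U, hU, hs⟩ := var_inv hM
    obtain ⟨⟨F, c⟩, hα, e, f⟩ := hs.exists_mem_comps (D, b) (by simp [comps_arrows])
    dsimp only at e f
    subst e
    exact ⟨U, hU, [], F, hα, .nil, f⟩
  | append_singleton M u ih =>
    rw [List.foldl_append] at hM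
    obtain ⟨V, h₁, h₂⟩ := app_inv hM (D, b) (by simp [comps_arrows])
    obtain ⟨U, hU, E, F, hc, hE, hF⟩ := ih (D := V :: D) h₁
    obtain ⟨W, F', hW, f', rfl⟩ := List.forall₂_cons_left_iff.1 hF
    exact ⟨U, hU, E ++ [W], F', by simpa using hc,
      List.rel_append hE (.cons (h₂.sub hW) .nil), f'⟩

end BCD

namespace Term

theorem exists_eq_spine (t : Term) (h : BetaNormal t) :
    ∃ r x M, t = lam^[r] (List.foldl app (var x) M) := by
  induction t with
  | var x => exact ⟨0, x, [], rfl⟩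
  | app s u ihs _ =>
    obtain ⟨r, x, M, rfl⟩ := ihs fun v hv => h _ (.appL u hv)
    cases r with
    | zero => exact ⟨0, x, M ++ [u], by simp⟩
    | succ r =>
      rw [Function.iterate_succ_apply'] at h
      exact absurd (.beta _ _) (h _)
  | lam t ih =>
    obtain ⟨r, x, M, rfl⟩ := ih fun v hv => h _ (.lam hv)
    exact ⟨r + 1, x, M, (Function.iterate_succ_apply' _ _ _).symm⟩

theorem BetaEtaNormal.betaNormal {t : Term} (h : BetaEtaNormal t) : BetaNormal t :=
  fun u hu => h u (.inl hu)

theorem BetaEtaNormal.of_lam {t : Term} (h : BetaEtaNormal (lam t)) : BetaEtaNormal t :=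
  fun u hu => h (lam u) (hu.imp .lam .lam)

theorem BetaEtaNormal.of_lams {r : ℕ} {t : Term} (h : BetaEtaNormal (lam^[r] t)) :
    BetaEtaNormal t := by
  induction r with
  | zero => exact h
  | succ r ih =>
    rw [Function.iterate_succ_apply'] at h
    exact ih h.of_lam

theorem BetaEtaNormal.of_spine {s : Term} (M : List Term) (h : BetaEtaNormal (M.foldl app s)) :
    BetaEtaNormal s ∧ ∀ u ∈ M, BetaEtaNormal u := by
  induction M generalizing s with
  | nil => simpa using h
  | cons v M ih =>
    obtain ⟨h₁, h₂⟩ := ih h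
    simp only [List.mem_cons, forall_eq_or_imp]
    exact ⟨fun u hu => h₁ _ (hu.imp (.appL v) (.appL v)),
      fun u hu => h₁ _ (hu.imp (.appR s) (.appR s)), h₂⟩

theorem sizeOf_le_lams (r : ℕ) (t : Term) : sizeOf t ≤ sizeOf (lam^[r] t) := by
  induction r with
  | zero => exact le_rfl
  | succ r ih =>
    rw [Function.iterate_succ_apply', lam.sizeOf_spec]
    omega

theorem sizeOf_lt_spine (s : Term) (M : List Term) :
    sizeOf s ≤ sizeOf (M.foldl app s) ∧ ∀ u ∈ M, sizeOf u < sizeOf (M.foldl app s) := by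
  induction M generalizing s with
  | nil => simp
  | cons v M ih =>
    obtain ⟨h₁, h₂⟩ := ih (app s v)
    rw [app.sizeOf_spec] at h₁
    simp only [List.foldl_cons, List.mem_cons, forall_eq_or_imp]
    exact ⟨by omega, by omega, h₂⟩

theorem exists_lift_spine {s : Term} (hs : ∃ u, s = lift 1 0 u) (M : List Term)
    (h : ∀ v ∈ M, ∃ u, v = lift 1 0 u) : ∃ u, M.foldl app s = lift 1 0 u := by
  induction M generalizing s with
  | nil => exact hs
  | cons v M ih =>
    simp only [List.mem_cons, forall_eq_or_imp] at h
    obtain ⟨⟨w, rfl⟩, h⟩ := h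
    obtain ⟨u, rfl⟩ := hs
    exact ih ⟨app u w, rfl⟩ h

theorem not_betaEtaNormal_lam_of_lift (u : Term) :
    ¬ BetaEtaNormal (lam (app (lift 1 0 u) (var 0))) :=
  fun h => h u (.inr (.eta u))

/-- The eta expansion `λ z₁ ... z_{r+1}. x z₁ ... z_{r+1}` is not eta normal. -/
theorem not_betaEtaNormal_eta_expansion {r x : ℕ} {M : List Term} (hM : M.length = r + 1)
    (h : ∀ j (hj : j < M.length), M[j] = var (r - j)) :
    ¬ BetaEtaNormal (lam^[r + 1] (M.foldl app (var (x + 1)))) := by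
  obtain rfl | ⟨N, u, rfl⟩ := List.eq_nil_or_concat' M
  · simp at hM
  have hN : N.length = r := by simpa using hM
  have hu : u = var 0 := by simpa [hN] using h r (by simp [hN])
  subst hu
  obtain ⟨w, hw⟩ := exists_lift_spine (s := var (x + 1)) ⟨var x, by simp [lift]⟩ N fun v hv => by
    obtain ⟨j, hj, rfl⟩ := List.getElem_of_mem hv
    have := h j (by simp; omega)
    rw [List.getElem_append_left hj] at this
    exact ⟨var (r - j - 1), by rw [this]; simp [lift]; omega⟩
  rw [Function.iterate_succ_apply, List.foldl_append, hw]
  exact fun h' => not_betaEtaNormal_lam_of_lift w h'.of_lams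

end Term

open Ty in
/-- If `x : T` in the basis `Γ`, `T ≤ G`, and every atom ends at most one component among those
which can become available as heads when inhabiting `G`, then `x` is the only beta-eta
normal inhabitant of `G`. -/
theorem BCD.eq_var_of_sub (Y : Term) (Γ : List Ty) (x : ℕ) (T G : Ty)
    (hY : Term.BetaEtaNormal Y) (hx : Γ[x]? = some T) (hTG : Sub T G)
    (hG : interOcc true G = 0) (hT : interOcc false T = 0)
    (hocc : ∀ c, (Γ.map (principalCount c)).sum + occ c false G + occ c true T ≤
      1 + principalCount c T)
    (hty : BCD Γ Y G) : Y = .var x := by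
  obtain ⟨D, b, rfl⟩ := exists_eq_arrows G hG
  obtain ⟨⟨E, b'⟩, hE, rfl, hDE⟩ := hTG.exists_mem_comps (D, b) (by simp [comps_arrows])
  dsimp only at hDE hocc hG hty hTG
  obtain ⟨r, h, M, rfl⟩ := Term.exists_eq_spine Y hY.betaNormal
  obtain ⟨hr, hM⟩ := hty.lams_inv
  obtain ⟨U, hU, E', F, hEF, hME, hF⟩ := BCD.spine_inv M hM
  have hpc (c : ℕ) (L : List Ty) : (L.map (principalCount c)).sum ≤ (L.map (occ c true)).sum :=
    List.sum_le_sum fun A _ => principalCount_le_occ c A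
  have hsplit (c : ℕ) : ((D.take r).map (occ c true)).sum ≤ (D.map (occ c true)).sum := by
    conv_rhs => rw [← List.take_append_drop r D, List.map_append, List.sum_append]
    exact Nat.le_add_right _ _
  have hlen : (D.take r).length = r := by simp [hr]
  have hbound : (((D.take r).reverse ++ Γ).map (principalCount b')).sum ≤ 1 := by
    have h₁ := hocc b'
    have h₂ := hpc b' (D.take r)
    have h₃ := hsplit b'
    have h₄ := principalCount_le_occ b' T
    rw [occ_false_arrows] at h₁
    rw [List.map_append, List.sum_append, List.map_reverse, List.sum_reverse]
    omega
  have hx' : ((D.take r).reverse ++ Γ)[x + r]? = some T := by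
    rw [List.getElem?_append_right (by simp [hr])]
    simpa [hr] using hx
  obtain ⟨rfl, hα⟩ := comps_unique hbound hU hx' hEF hE rfl rfl
  obtain rfl : E' ++ F = E := congrArg Prod.fst hα
  have hMr : M.length = r := by
    have h₁ := hDE.length_eq
    have h₂ := hF.length_eq
    have h₃ := hME.length_eq
    simp only [List.length_append, List.length_drop] at h₁ h₂
    omega
  have hargs : ∀ j (hj : j < M.length), M[j] = Term.var (r - 1 - j) := by
    intro j hj
    obtain ⟨hl, hget⟩ := List.forall₂_iff_get.1 hME
    obtain ⟨hl', hget'⟩ := List.forall₂_iff_get.1 hDE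
    have hjE : j < E'.length := hl ▸ hj
    have hjD : j < D.length := by omega
    have hmem : E'[j] ∈ E' ++ F := List.mem_append_left _ (List.getElem_mem hjE)
    have hsize : sizeOf M[j] < sizeOf (Term.lam^[r] (M.foldl Term.app (.var (x + r)))) :=
      ((Term.sizeOf_lt_spine _ M).2 _ (List.getElem_mem hj)).trans_le (Term.sizeOf_le_lams _ _)
    refine BCD.eq_var_of_sub M[j] ((D.take r).reverse ++ Γ) (r - 1 - j) D[j] E'[j]
      (hY.of_lams.of_spine.2 _ (List.getElem_mem hj)) ?_ ?_ ?_ ?_ ?_ (hget j hj hjE)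
    · rw [List.getElem?_append_left (by simp; omega), List.getElem?_reverse (by omega), hlen]
      rw [List.getElem?_take_of_lt (by omega), List.getElem?_eq_getElem (by omega)]
      congr 2
      omega
    · have := hget' j hjD (by simp; omega)
      simpa [List.getElem_append_left hjE] using this
    · exact interOcc_eq_zero_of_mem_comps T _ hE hT _ hmem
    · exact interOcc_false_of_arrows D b' hG _ (List.getElem_mem hjD)
    · intro c
      have h₁ := hocc c
      have h₂ := sum_occ_add_principalCount_le c T _ hE
      have h₃ : occ c false E'[j] ≤ ((E' ++ F).map (occ c false)).sum :=
        List.le_sum_of_mem (List.mem_map.2 ⟨_, hmem, rfl⟩)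
      have h₄ := hsplit c
      have h₅ : ((D.take r).map (principalCount c)).sum + occ c true D[j] ≤
          ((D.take r).map (occ c true)).sum + principalCount c D[j] := by
        have hjr : j < (D.take r).length := by omega
        have e : (D.take r)[j] = D[j] := List.getElem_take
        have hp := List.perm_cons_erase (List.getElem_mem hjr)
        rw [(hp.map _).sum_eq, (hp.map _).sum_eq, e]
        have := hpc c ((D.take r).erase D[j])
        simp only [List.map_cons, List.sum_cons]
        omega
      rw [occ_false_arrows] at h₁
      rw [List.map_append, List.sum_append, List.map_reverse, List.sum_reverse]
      dsimp only at h₂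
      omega
  cases r with
  | zero =>
    obtain rfl := List.eq_nil_of_length_eq_zero hMr
    rfl
  | succ r => exact absurd hY (Term.not_betaEtaNormal_eta_expansion (x := x + r) hMr hargs)
termination_by sizeOf Y
decreasing_by
  subst_vars
  exact hsize

/-- Eta Normal Form Lemma: Suppose
`A = A₁ → ( ... (Aₙ → a) ...)` is functional,
`A_{k+1} = C₁ → ( ... (C_p → (B_{k+2} → ( ... (Bₙ → a) ...))) ...)`, and
`A_i ≤ B_i` for `i = k+2, ..., n`.  Let `Y` be in beta-eta normal form.  If
`k+1 < i ≤ n` and `x₁:A₁, ..., x_{k+1}:A_{k+1}, y_{k+2}:A_{k+2}, ..., yₙ:Aₙ ⊢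
Y : B_i` is derivable in BCD (the basis being the list `[A₁, ..., Aₙ]`, the
variable `x_j` resp. `y_j` being de Bruijn index `j - 1`), then `Y` is the
variable `y_i`. -/
theorem eta_normal_form_lemma (n k p i a : ℕ) (A B C : ℕ → Ty) (Y : Term)
    (hk : k + 1 < i) (hi : i ≤ n)
    (hfun : Ty.Functional (Ty.arrows ((List.range n).map fun j => A (j + 1)) (Ty.atom a)))
    (hAk : A (k + 1) =
      Ty.arrows ((List.range p).map fun j => C (j + 1))
        (Ty.arrows ((List.range (n - (k + 1))).map fun j => B (k + 2 + j)) (Ty.atom a)))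
    (hsub : ∀ j, k + 2 ≤ j → j ≤ n → Ty.Sub (A j) (B j))
    (hY : Term.BetaEtaNormal Y)
    (hty : BCD ((List.range n).map fun j => A (j + 1)) Y (B i)) :
    Y = Term.var (i - 1) := by
  set As := (List.range n).map fun j => A (j + 1) with hAs
  have hget (j : ℕ) (hj : j < n) : As[j]? = some (A (j + 1)) := by simp [hAs, hj]
  obtain ⟨-, hocc, hinter⟩ := hfun
  have hmem (j : ℕ) (hj : j < n) : A (j + 1) ∈ As := List.mem_of_getElem? (hget j hj)
  have hfalse := Ty.interOcc_false_of_arrows As a hinter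
  have hi' : i - 1 + 1 = i := by omega
  have hk' := hmem k (by omega)
  set E := ((List.range p).map fun j => C (j + 1)) ++
    (List.range (n - (k + 1))).map fun j => B (k + 2 + j) with hE
  have hcomp : (E, a) ∈ Ty.comps (A (k + 1)) := by
    rw [hAk, show ∀ l m : List Ty, Ty.arrows l (Ty.arrows m (.atom a)) =
      Ty.arrows (l ++ m) (.atom a) from fun l m => by simp [Ty.arrows], Ty.comps_arrows]
    simp [hE]
  have hB : B i ∈ E := by
    refine List.mem_append_right _ (List.mem_map.2 ⟨i - (k + 2), ?_, ?_⟩)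
    · rw [List.mem_range]; omega
    · congr 1; omega
  refine BCD.eq_var_of_sub Y As (i - 1) (A i) (B i) hY ?_ (hsub i (by omega) hi) ?_ ?_ ?_ hty
  · simpa [hi'] using hget (i - 1) (by omega)
  · exact Ty.interOcc_eq_zero_of_mem_comps _ _ hcomp (hfalse _ hk') _ hB
  · simpa [hi'] using hfalse _ (hmem (i - 1) (by omega))
  · intro c
    have h₁ := (hocc c).2
    have h₂ := Ty.sum_occ_add_principalCount_le c _ _ hcomp
    have h₃ : Ty.occ c false (B i) ≤ (E.map (Ty.occ c false)).sum :=
      List.le_sum_of_mem (List.mem_map.2 ⟨_, hB, rfl⟩)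
    have h₄ := Ty.principalCount_le_occ c (A i)
    have hsum (f : Ty → ℕ) : (As.map f).sum = ∑ j ∈ Finset.range n, f (A (j + 1)) := by
      rw [hAs, List.map_map]
      rfl
    rw [Ty.occ_false_arrows, hsum] at h₁
    have h₅ : ∑ j ∈ Finset.range n, (Ty.principalCount c (A (j + 1)) +
        (if j = k then Ty.occ c false (B i) else 0) +
        (if j = i - 1 then Ty.occ c true (A i) - Ty.principalCount c (A i) else 0)) ≤
        ∑ j ∈ Finset.range n, Ty.occ c true (A (j + 1)) := by
      refine Finset.sum_le_sum fun j _ => ?_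
      have h₆ := Ty.principalCount_le_occ c (A (j + 1))
      dsimp only at h₂
      by_cases hjk : j = k
      · subst hjk
        rw [if_pos rfl, if_neg (by omega)]
        omega
      · by_cases hji : j = i - 1
        · subst hji
          rw [if_neg hjk, if_pos rfl, hi']
          omega
        · rw [if_neg hjk, if_neg hji]
          omega
    rw [Finset.sum_add_distrib, Finset.sum_add_distrib, Finset.sum_ite_eq', Finset.sum_ite_eq',
      if_pos (by rw [Finset.mem_range]; omega), if_pos (by rw [Finset.mem_range]; omega)] at h₅
    rw [hsum]
    omega
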